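/- arXiv:math/9812089 — 11 statements merged into one kernel-verified Lean document; each statement's English description precedes it below -/
import Mathlib

section
/- Let m and n be positive integers with n composite (n > 1 and n not prime). Then the following are equivalent: (a) for every commutative ring A equipped with a Z/nZ-algebra structure that can be generated as a Z/nZ-module by at most m elements, the map x ↦ x^n is a ring endomorphism of A (equivalently, (x+y)^n = x^n + y^n for all x, y in A); (c) n is squarefree, and for every prime p dividing n and every integer r with 1 ≤ r ≤ m there exists an integer i ≥ 0 such that n ≡ p^i (mod p^r − 1). -/
theorem Submodule.span_zmod_toAddSubgroup {n : ℕ} {M : Type*} [AddCommGroup M]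
    [Module (ZMod n) M] (s : Set M) :
    (span (ZMod n) s).toAddSubgroup = AddSubgroup.closure s := by
  apply le_antisymm
  · have h : span (ZMod n) s ≤ AddSubgroup.toZModSubmodule n (AddSubgroup.closure s) :=
      span_le.2 AddSubgroup.subset_closure
    exact fun x hx => h hx
  · exact (AddSubgroup.closure_le _).2 subset_span

theorem Submodule.span_zmod_eq_top_iff {n : ℕ} {M : Type*} [AddCommGroup M]
    [Module (ZMod n) M] (s : Set M) :
    span (ZMod n) s = ⊤ ↔ AddSubgroup.closure s = ⊤ := by
  rw [← span_zmod_toAddSubgroup (n := n), ← Submodule.top_toAddSubgroup (R := ZMod n),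
    Submodule.toAddSubgroup_inj]

theorem FiniteField.exists_modEq_prime_pow_of_add_pow (p : ℕ) [Fact p.Prime] (F : Type*) [Field F]
    [Finite F] [Algebra (ZMod p) F] {n : ℕ} (hn : n ≠ 0)
    (hadd : ∀ x y : F, (x + y) ^ n = x ^ n + y ^ n) :
    ∃ i, n ≡ p ^ i [MOD Nat.card F - 1] := by
  have := Fintype.ofFinite F
  let f : F →+* F :=
    { toFun x := x ^ n
      map_one' := one_pow n
      map_mul' x y := mul_pow x y n
      map_zero' := zero_pow hn
      map_add' := hadd }
  let φ : F →ₐ[ZMod p] F :=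
    { f with commutes' := fun c => RingHom.congr_fun (RingHom.ext_zmod
        (f.comp (algebraMap (ZMod p) F)) (algebraMap (ZMod p) F)) c }
  obtain ⟨i, hi⟩ := (bijective_frobeniusAlgHom_pow (ZMod p) F).2 φ
  refine ⟨i, ?_⟩
  obtain ⟨g, hg⟩ := IsCyclic.exists_generator (α := Fˣ)
  have hpow : g ^ n = g ^ p ^ (i : ℕ) := by
    ext
    have h := DFunLike.congr_fun hi (g : F)
    simp only [AlgHom.coe_pow, coe_frobeniusAlgHom, pow_iterate, ZMod.card] at h
    rw [Units.val_pow_eq_pow_val, Units.val_pow_eq_pow_val]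
    exact h.symm
  rwa [pow_eq_pow_iff_modEq, orderOf_eq_card_of_forall_mem_zpowers hg, Nat.card_units] at hpow

theorem squarefree_of_forall_zmod_add_pow {n : ℕ} (hn : 1 < n)
    (hadd : ∀ x y : ZMod n, (x + y) ^ n = x ^ n + y ^ n) : Squarefree n := by
  have hnat (a : ℕ) : (a : ZMod n) ^ n = a := by
    induction a with
    | zero => simp [show n ≠ 0 by omega]
    | succ a ih => rw [Nat.cast_succ, hadd, ih, one_pow]
  rw [Nat.squarefree_iff_prime_squarefree]
  intro p hp hpn
  have hmod : p ^ n ≡ p [MOD n] := by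
    rw [← ZMod.natCast_eq_natCast_iff]
    exact_mod_cast hnat p
  have hdvd : p * p ∣ p ^ n := by
    rw [← sq]
    exact pow_dvd_pow p hn
  have hpp := ((hmod.of_dvd hpn).dvd_iff dvd_rfl).1 hdvd
  have := Nat.le_of_dvd hp.pos hpp
  nlinarith [hp.two_le]

theorem exists_modEq_of_forall_algebra_add_pow {m n : ℕ} (hn : 1 < n)
    (hadd : ∀ (A : Type) [CommRing A] [Algebra (ZMod n) A],
      (∃ s : Finset A, s.card ≤ m ∧ Submodule.span (ZMod n) (s : Set A) = ⊤) →
      ∀ x y : A, (x + y) ^ n = x ^ n + y ^ n)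
    {p : ℕ} (hp : p.Prime) (hpn : p ∣ n) {r : ℕ} (hr : 1 ≤ r) (hrm : r ≤ m) :
    ∃ i, n ≡ p ^ i [MOD p ^ r - 1] := by
  classical
  have : Fact p.Prime := ⟨hp⟩
  have hr0 : r ≠ 0 := by omega
  let _ : Algebra (ZMod n) (GaloisField p r) := ZMod.algebra' _ p hpn
  have : Finite (GaloisField p r) := Nat.finite_of_card_ne_zero (by
    rw [GaloisField.card p r hr0]
    exact pow_ne_zero _ hp.ne_zero)
  let b := Module.finBasis (ZMod p) (GaloisField p r)
  rw [← GaloisField.card p r hr0]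
  refine FiniteField.exists_modEq_prime_pow_of_add_pow p _ (by omega)
    (hadd _ ⟨Finset.univ.image b, ?_, ?_⟩)
  · refine Finset.card_image_le.trans ?_
    rwa [Finset.card_univ, Fintype.card_fin, GaloisField.finrank p hr0]
  · rw [Submodule.span_zmod_eq_top_iff, ← Submodule.span_zmod_eq_top_iff (n := p),
      Finset.coe_image, Finset.coe_univ, Set.image_univ, b.span_eq]

theorem lt_prime_of_forall_exists_modEq {m n : ℕ} (hcomp : ¬ n.Prime)
    (hsq : Squarefree n)
    (hmod : ∀ p : ℕ, p.Prime → p ∣ n → ∀ r : ℕ, 1 ≤ r → r ≤ m →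
      ∃ i : ℕ, n ≡ p ^ i [MOD p ^ r - 1])
    {p : ℕ} (hp : p.Prime) (hpn : p ∣ n) : m < p := by
  by_contra! hmp
  obtain ⟨k, rfl⟩ := hpn
  obtain ⟨q, hq, hqk⟩ := Nat.exists_prime_and_dvd (n := k) (by
    rintro rfl
    exact hcomp (by simpa using hp))
  have hqp : ¬ p ∣ q := by
    rw [Nat.prime_dvd_prime_iff_eq hp hq]
    rintro rfl
    exact hp.not_isUnit (hsq p (mul_dvd_mul_left p hqk))
  obtain ⟨i, hi⟩ := hmod q hq (hqk.mul_left p) (p - 1) (Nat.le_sub_one_of_lt hp.one_lt)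
    ((Nat.sub_le p 1).trans hmp)
  have hfermat : p ∣ q ^ (p - 1) - 1 :=
    (Nat.modEq_iff_dvd' (Nat.one_le_pow _ _ hq.pos)).1
      (Nat.ModEq.pow_card_sub_one_eq_one hp ((hp.coprime_iff_not_dvd.2 hqp).symm)).symm
  exact hqp (hp.dvd_of_dvd_pow (((hi.of_dvd hfermat).dvd_iff dvd_rfl).1 (dvd_mul_right p k)))

theorem Algebra.pow_finrank_eq_zero_of_isNilpotent (K : Type*) {B : Type*} [Field K] [CommRing B]
    [Algebra K B] [Module.Finite K B] {w : B} (hw : IsNilpotent w) :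
    w ^ Module.finrank K B = 0 := by
  have h := LinearMap.aeval_self_charpoly (Algebra.lmul K B w)
  rw [(hw.map (Algebra.lmul K B)).charpoly_eq_X_pow_finrank, map_pow, Polynomial.aeval_X,
    ← map_pow] at h
  simpa using DFunLike.congr_fun h 1

theorem FiniteField.pow_eq_pow_prime_pow (p : ℕ) [Fact p.Prime] {F : Type*} [Field F]
    [Algebra (ZMod p) F] [Module.Finite (ZMod p) F] {n i : ℕ} (hn : n ≠ 0)
    (hi : n ≡ p ^ i [MOD p ^ Module.finrank (ZMod p) F - 1]) (x : F) : x ^ n = x ^ p ^ i := by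
  have : Finite F := Module.finite_of_finite (ZMod p)
  have := Fintype.ofFinite F
  have hp : p ≠ 0 := (Fact.out : p.Prime).ne_zero
  rcases eq_or_ne x 0 with rfl | hx
  · rw [zero_pow hn, zero_pow (pow_ne_zero _ hp)]
  · refine pow_eq_pow_of_modEq hi ?_
    rw [FiniteField.pow_finrank_eq_card]
    exact pow_card_sub_one_eq_one x hx

theorem add_pow_of_finrank_lt (p : ℕ) [Fact p.Prime] {B : Type*} [CommRing B]
    [Algebra (ZMod p) B] [Module.Finite (ZMod p) B] (hB : Module.finrank (ZMod p) B < p)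
    {n : ℕ} (hn : n ≠ 0) (hpn : p ∣ n)
    (hmod : ∀ r, 1 ≤ r → r ≤ Module.finrank (ZMod p) B → ∃ i, n ≡ p ^ i [MOD p ^ r - 1])
    (x y : B) : (x + y) ^ n = x ^ n + y ^ n := by
  nontriviality B
  have : CharP B p := charP_of_injective_algebraMap (algebraMap (ZMod p) B).injective p
  obtain ⟨k, hk⟩ := hpn
  have hpow : ((x + y) ^ k - x ^ k - y ^ k) ^ p = (x + y) ^ n - x ^ n - y ^ n := by
    rw [sub_pow_char, sub_pow_char, ← pow_mul, ← pow_mul, ← pow_mul, mul_comm k p, hk]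
  have hnil : IsNilpotent ((x + y) ^ k - x ^ k - y ^ k) := by
    have : IsArtinianRing B := .of_finite (ZMod p) B
    rw [← mem_nilradical, nilradical_eq_sInf, Ideal.mem_sInf]
    intro M (hM : M.IsPrime)
    have hmax : M.IsMaximal := inferInstance
    let _ : Field (B ⧸ M) := Ideal.Quotient.field M
    refine hM.mem_of_pow_mem p ?_
    rw [hpow, ← Ideal.Quotient.eq_zero_iff_mem]
    have hsurj : Function.Surjective (Ideal.Quotient.mkₐ (ZMod p) M).toLinearMap :=
      Ideal.Quotient.mkₐ_surjective (ZMod p) M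
    obtain ⟨i, hi⟩ := hmod (Module.finrank (ZMod p) (B ⧸ M)) Module.finrank_pos
      (LinearMap.finrank_le_finrank_of_surjective hsurj)
    have : CharP (B ⧸ M) p :=
      charP_of_injective_algebraMap (algebraMap (ZMod p) (B ⧸ M)).injective p
    simp only [map_sub, map_pow, map_add, FiniteField.pow_eq_pow_prime_pow p hn hi]
    rw [add_pow_char_pow]
    ring
  have h0 : ((x + y) ^ k - x ^ k - y ^ k) ^ p = 0 :=
    pow_eq_zero_of_le hB.le (Algebra.pow_finrank_eq_zero_of_isNilpotent (ZMod p) hnil)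
  rw [hpow] at h0
  linear_combination h0

theorem eq_zero_of_forall_prime_dvd {n : ℕ} (hn : Squarefree n) {A : Type*} [CommRing A]
    (hA : (n : A) = 0) {z : A} (hz : ∀ p : ℕ, p.Prime → p ∣ n → (p : A) ∣ z) : z = 0 := by
  by_contra hz0
  obtain ⟨p, hp, hpz⟩ := Nat.exists_prime_and_dvd (mt AddMonoid.addOrderOf_eq_one_iff.1 hz0)
  obtain ⟨k, rfl⟩ : p ∣ n := hpz.trans (addOrderOf_dvd_of_nsmul_eq_zero (by
    rw [nsmul_eq_mul, hA, zero_mul]))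
  obtain ⟨a, rfl⟩ := hz p hp (dvd_mul_right p k)
  have hpk : p ∣ k := hpz.trans (addOrderOf_dvd_of_nsmul_eq_zero (by
    rw [nsmul_eq_mul, ← mul_assoc, ← Nat.cast_mul, mul_comm k, hA, zero_mul]))
  exact hp.not_isUnit (hn p (mul_dvd_mul_left p hpk))

theorem add_pow_of_forall_exists_modEq {m n : ℕ} (hn : 1 < n) (hcomp : ¬ n.Prime)
    (hsq : Squarefree n)
    (hmod : ∀ p : ℕ, p.Prime → p ∣ n → ∀ r : ℕ, 1 ≤ r → r ≤ m →
      ∃ i : ℕ, n ≡ p ^ i [MOD p ^ r - 1])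
    {A : Type*} [CommRing A] [Algebra (ZMod n) A] {s : Finset A} (hs : s.card ≤ m)
    (hspan : Submodule.span (ZMod n) (s : Set A) = ⊤) (x y : A) :
    (x + y) ^ n = x ^ n + y ^ n := by
  classical
  have hA : (n : A) = 0 := by
    rw [← map_natCast (algebraMap (ZMod n) A), ZMod.natCast_self, map_zero]
  rw [← sub_eq_zero]
  refine eq_zero_of_forall_prime_dvd hsq hA fun p hp hpn => ?_
  have : Fact p.Prime := ⟨hp⟩
  let I := Ideal.span {(p : A)}
  let f : A →+* A ⧸ I := Ideal.Quotient.mk I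
  have hf : Function.Surjective f := Ideal.Quotient.mk_surjective
  let _ : Algebra (ZMod p) (A ⧸ I) :=
    letI : Module (ZMod p) (A ⧸ I) := AddCommGroup.zmodModule fun b => by
      rw [nsmul_eq_mul, ← map_natCast f,
        Ideal.Quotient.eq_zero_iff_mem.2 (Ideal.mem_span_singleton_self (p : A)), zero_mul]
    ZMod.algebraOfModule p _
  have htop : Submodule.span (ZMod p) ((s.image f : Finset (A ⧸ I)) : Set (A ⧸ I)) = ⊤ := by
    rw [Submodule.span_zmod_eq_top_iff] at hspan ⊢
    rw [Finset.coe_image]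
    have h := AddMonoidHom.map_closure (f : A →+ A ⧸ I) s
    rw [hspan, AddSubgroup.map_top_of_surjective _ hf] at h
    exact h.symm
  have : Module.Finite (ZMod p) (A ⧸ I) := ⟨⟨s.image f, htop⟩⟩
  have hrank : Module.finrank (ZMod p) (A ⧸ I) ≤ m := by
    rw [← finrank_top (ZMod p), ← htop]
    exact (finrank_span_finset_le_card _).trans (Finset.card_image_le.trans hs)
  have hadd := add_pow_of_finrank_lt p
    (hrank.trans_lt (lt_prime_of_forall_exists_modEq hcomp hsq hmod hp hpn)) (by omega) hpn
    (fun r hr hrm => hmod p hp hpn r hr (hrm.trans hrank)) (f x) (f y)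
  rw [← Ideal.mem_span_singleton, ← Ideal.Quotient.eq_zero_iff_mem]
  simpa [sub_eq_zero] using hadd

/-- **Theorem 1.1 (Howe), (a) ⇔ (c).**
Let `m` and `n` be positive integers with `n` composite.  Then `n`-th power raising is a
ring endomorphism of every commutative `ZMod n`-algebra that can be generated as a
`ZMod n`-module by at most `m` elements, if and only if `n` is squarefree and for every
prime `p ∣ n` and every `1 ≤ r ≤ m` there is an `i ≥ 0` with `n ≡ p^i (mod p^r − 1)`. -/
theorem stmt_0 (m n : ℕ) (hm : 0 < m) (hn : 1 < n) (hcomp : ¬ n.Prime) :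
    (∀ (A : Type) [CommRing A] [Algebra (ZMod n) A],
        (∃ s : Finset A, s.card ≤ m ∧ Submodule.span (ZMod n) (s : Set A) = ⊤) →
        ∀ x y : A, (x + y) ^ n = x ^ n + y ^ n)
      ↔
    (Squarefree n ∧
      ∀ p : ℕ, p.Prime → p ∣ n → ∀ r : ℕ, 1 ≤ r → r ≤ m →
        ∃ i : ℕ, n ≡ p ^ i [MOD p ^ r - 1]) := by
  constructor
  · intro hadd
    refine ⟨squarefree_of_forall_zmod_add_pow hn (hadd (ZMod n) ⟨{1}, hm, ?_⟩),
      fun p hp hpn r hr hrm => exists_modEq_of_forall_algebra_add_pow hn hadd hp hpn hr hrm⟩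
    rw [Finset.coe_singleton]
    exact Ideal.span_singleton_one
  · rintro ⟨hsq, hmod⟩ A _ _ ⟨s, hs, hspan⟩
    exact add_pow_of_forall_exists_modEq hn hcomp hsq hmod hs hspan
end

section
/- Let n > 1 be an integer such that a^n ≡ a (mod n) for every integer a. Then n is squarefree. -/
/-- If `n > 1` and `a^n ≡ a (mod n)` for every integer `a`, then `n` is squarefree. -/
theorem stmt_1 (n : ℕ) (hn : 1 < n) (h : ∀ a : ℤ, a ^ n ≡ a [ZMOD (n : ℤ)]) :
    Squarefree n := by
  rw [Nat.squarefree_iff_prime_squarefree]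
  intro p hp hpn
  have hsq : (p : ℤ) ^ 2 ∣ n := by
    rw [pow_two]
    exact_mod_cast hpn
  have hdvd : (p : ℤ) ^ 2 ∣ p :=
    (dvd_sub_left (pow_dvd_pow _ hn)).mp (hsq.trans (h p).dvd)
  have hle : p ^ 2 ≤ p := Nat.le_of_dvd hp.pos (by exact_mod_cast hdvd)
  nlinarith [hp.two_le]
end

section
/- Let F be a finite field with p^r elements, where p is prime and r ≥ 1, and let n be a positive integer. If the map x ↦ x^n is a ring endomorphism of F (equivalently, (x+y)^n = x^n + y^n for all x, y in F), then there exists an integer i ≥ 0 such that n ≡ p^i (mod p^r − 1), and consequently x^n = x^(p^i) for all x in F. -/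
/-- Every ring endomorphism of a finite field of characteristic `p` is a power of Frobenius. -/
theorem FiniteField.exists_ringHom_eq_pow {F : Type*} [Field F] [Finite F] (p : ℕ)
    [Fact p.Prime] [CharP F p] (f : F →+* F) : ∃ i : ℕ, ∀ x, f x = x ^ p ^ i := by
  let : Algebra (ZMod p) F := ZMod.algebra F p
  let g : F →ₐ[ZMod p] F := { f with
    commutes' := fun c => RingHom.congr_fun
      (Subsingleton.elim (f.comp (algebraMap (ZMod p) F)) (algebraMap (ZMod p) F)) c }
  obtain ⟨i, hi⟩ := (FiniteField.bijective_frobeniusAlgHom_pow (ZMod p) F).2 g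
  refine ⟨i, fun x => ?_⟩
  have h : (FiniteField.frobeniusAlgHom (ZMod p) F ^ i.1) x = g x := DFunLike.congr_fun hi x
  rw [AlgHom.coe_pow, FiniteField.coe_frobeniusAlgHom, pow_iterate, ZMod.card] at h
  exact h.symm

/-- If `F` is a finite field with `p^r` elements and `x ↦ x^n` is a ring endomorphism of
`F` (equivalently, is additive), then there is an `i ≥ 0` with `n ≡ p^i (mod p^r − 1)`,
and `x^n = x^(p^i)` for all `x ∈ F`. -/
theorem stmt_2 (p r n : ℕ) (hp : p.Prime) (hr : 1 ≤ r) (hn : 0 < n)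
    (F : Type) [Field F] [Fintype F] (hF : Fintype.card F = p ^ r)
    (hend : ∀ x y : F, (x + y) ^ n = x ^ n + y ^ n) :
    ∃ i : ℕ, n ≡ p ^ i [MOD p ^ r - 1] ∧ ∀ x : F, x ^ n = x ^ p ^ i := by
  have : Fact p.Prime := ⟨hp⟩
  have : CharP F p := charP_of_card_eq_prime_pow hF
  let f : F →+* F :=
    { toFun := (· ^ n)
      map_one' := one_pow n
      map_mul' := fun x y => mul_pow x y n
      map_zero' := zero_pow hn.ne'
      map_add' := hend }
  obtain ⟨i, hi⟩ := FiniteField.exists_ringHom_eq_pow p f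
  refine ⟨i, ?_, hi⟩
  obtain ⟨g, hg⟩ := IsCyclic.exists_ofOrder_eq_natCard (α := Fˣ)
  rw [Nat.card_units, Nat.card_eq_fintype_card, hF] at hg
  rw [← hg, ← pow_eq_pow_iff_modEq]
  exact Units.ext (by simpa only [Units.val_pow_eq_pow_val] using! hi g)
end

section
/- Let m and n be positive integers such that n is composite, squarefree, and such that for every prime divisor p of n and every integer r with 1 ≤ r ≤ m there exists an integer i ≥ 0 with n ≡ p^i (mod p^r − 1). Then for every integer r with 1 ≤ r ≤ m, the binomial coefficient C(n, r) is divisible by n. -/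
/-- A squarefree composite number has, besides any given prime factor, another one. -/
theorem exists_prime_dvd_ne_of_squarefree {n q : ℕ} (hcomp : ¬ n.Prime)
    (hsf : Squarefree n) (hq : q.Prime) (hqn : q ∣ n) :
    ∃ p : ℕ, p.Prime ∧ p ∣ n ∧ p ≠ q := by
  obtain ⟨k, rfl⟩ := hqn
  have hk : k ≠ 1 := by
    rintro rfl
    exact hcomp (by simpa using hq)
  refine ⟨k.minFac, Nat.minFac_prime hk, (Nat.minFac_dvd k).mul_left q, fun h => ?_⟩
  have hqk : q ∣ k := h ▸ Nat.minFac_dvd k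
  exact hq.one_lt.ne' (Nat.isUnit_iff.mp (hsf q (mul_dvd_mul_left q hqk)))

/-- If `n` is a power of `p` modulo `p ^ (q - 1) - 1`, then `n` has no prime factor `q ≠ p`. -/
theorem not_dvd_of_modEq_pow {n p q i : ℕ} (hp : p.Prime) (hq : q.Prime) (hpq : p ≠ q)
    (h : n ≡ p ^ i [MOD p ^ (q - 1) - 1]) : ¬ q ∣ n := by
  intro hqn
  have hcop : p.Coprime q := (Nat.coprime_primes hp hq).mpr hpq
  have hfermat : p ^ (q - 1) ≡ 1 [MOD q] := by
    simpa [Nat.totient_prime hq] using Nat.ModEq.pow_totient hcop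
  have hdvd : q ∣ p ^ (q - 1) - 1 :=
    (Nat.modEq_iff_dvd' (Nat.one_le_pow _ _ hp.pos)).mp hfermat.symm
  have hqp : q ∣ p ^ i := ((h.of_dvd hdvd).dvd_iff dvd_rfl).mp hqn
  exact hpq ((Nat.prime_dvd_prime_iff_eq hq hp).mp (hq.dvd_of_dvd_pow hqp)).symm

/-- If `r` is positive and coprime to `n`, then `n` divides `n.choose r`. -/
theorem Nat.Coprime.dvd_choose_self {n r : ℕ} (hr : 0 < r) (h : n.Coprime r) :
    n ∣ n.choose r := by
  obtain ⟨s, rfl⟩ := Nat.exists_eq_add_of_lt hr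
  rcases n with _ | n
  · simp
  · refine h.dvd_of_dvd_mul_right ⟨n.choose s, ?_⟩
    simpa using (Nat.add_one_mul_choose_eq n s).symm


/-- **Lemma 2.1.** If `n` is a squarefree composite integer satisfying condition (c) of
the main theorem for order `m`, then `n` divides `C(n, r)` for `1 ≤ r ≤ m`. -/
theorem stmt_3 (m n : ℕ) (hm : 0 < m) (hn : 1 < n) (hcomp : ¬ n.Prime)
    (hsf : Squarefree n)
    (hcong : ∀ p : ℕ, p.Prime → p ∣ n → ∀ r : ℕ, 1 ≤ r → r ≤ m →
      ∃ i : ℕ, n ≡ p ^ i [MOD p ^ r - 1]) :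
    ∀ r : ℕ, 1 ≤ r → r ≤ m → n ∣ n.choose r := by
  intro r hr hrm
  refine Nat.Coprime.dvd_choose_self hr (Nat.coprime_of_dvd fun q hq hqn hqr => ?_)
  obtain ⟨p, hp, hpn, hpq⟩ := exists_prime_dvd_ne_of_squarefree hcomp hsf hq hqn
  have hqr' : q ≤ r := Nat.le_of_dvd hr hqr
  have hq2 : 2 ≤ q := hq.two_le
  obtain ⟨i, hi⟩ := hcong p hp hpn (q - 1) (by omega) (by omega)
  exact not_dvd_of_modEq_pow hp hq hpq hi hqn
end

section
/- Let m and n be positive integers such that n is composite, squarefree, and such that for every prime divisor p of n and every integer r with 1 ≤ r ≤ m there exists an integer i ≥ 0 with n ≡ p^i (mod p^r − 1). Then every prime divisor of n is strictly greater than m. -/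
/-- **Lemma 2.1 (reformulated).** If `n` is a squarefree composite integer satisfying
condition (c) of the main theorem for order `m`, then every prime divisor of `n` is
strictly greater than `m`. -/
theorem stmt_4 (m n : ℕ) (hm : 0 < m) (hn : 1 < n) (hcomp : ¬ n.Prime)
    (hsf : Squarefree n)
    (hcong : ∀ p : ℕ, p.Prime → p ∣ n → ∀ r : ℕ, 1 ≤ r → r ≤ m →
      ∃ i : ℕ, n ≡ p ^ i [MOD p ^ r - 1]) :
    ∀ q : ℕ, q.Prime → q ∣ n → m < q := by
  intro q hq hqn
  by_contra! hqm
  obtain ⟨k, rfl⟩ := hqn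
  have hk : k ≠ 1 := by
    rintro rfl
    exact hcomp (by simpa using hq)
  obtain ⟨p, hp, hpk⟩ := Nat.exists_prime_and_dvd hk
  have hpq : p ≠ q := by
    rintro rfl
    exact hp.one_lt.ne' (Nat.isUnit_iff.mp (hsf p (mul_dvd_mul_left p hpk)))
  have hq2 := hq.two_le
  obtain ⟨i, hi⟩ := hcong p hp (hpk.mul_left q) (q - 1) (by omega) (by omega)
  have hfermat : p ^ (q - 1) ≡ 1 [MOD q] := by
    rw [← Nat.totient_prime hq]
    exact Nat.ModEq.pow_totient ((Nat.coprime_primes hp hq).mpr hpq)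
  have hdvd : q ∣ p ^ (q - 1) - 1 :=
    (Nat.modEq_iff_dvd' (Nat.one_le_pow _ _ hp.pos)).mp hfermat.symm
  have hqpow : q ∣ p ^ i := ((hi.of_dvd hdvd).dvd_iff dvd_rfl).mp (dvd_mul_right q k)
  exact hpq ((Nat.prime_dvd_prime_iff_eq hq hp).mp (hq.dvd_of_dvd_pow hqpow)).symm
end

section
/- Let R be a commutative ring, let m and n be positive integers, and let a, z be elements of R such that z^m = 0 and such that the image in R of the binomial coefficient C(n, r) is 0 for every integer r with 1 ≤ r ≤ m. Then (a + z)^n = a^n. -/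
/-- The binomial computation: if `z^m = 0` and the binomial coefficients `C(n, r)`
vanish in `R` for `1 ≤ r ≤ m`, then `(a + z)^n = a^n`. -/
theorem stmt_7 (R : Type) [CommRing R] (m n : ℕ) (hm : 0 < m) (hn : 0 < n)
    (a z : R) (hz : z ^ m = 0)
    (hbin : ∀ r : ℕ, 1 ≤ r → r ≤ m → ((n.choose r : ℕ) : R) = 0) :
    (a + z) ^ n = a ^ n := by
  rw [add_comm, add_pow, Finset.sum_eq_single 0]
  · simp
  · intro r _ hr
    rcases le_total r m with h | h
    · rw [hbin r (Nat.one_le_iff_ne_zero.mpr hr) h, mul_zero]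
    · rw [pow_eq_zero_of_le h hz, zero_mul, zero_mul]
  · simp
end

section
/- Let m ≥ 1 and let L be a positive integer. Suppose n > 1 is a squarefree composite integer with n ≡ 1 (mod L), and suppose that every prime divisor p of n satisfies: p does not divide L, and p^r − 1 divides L for every integer r with 1 ≤ r ≤ m. Then for every prime divisor p of n and every r with 1 ≤ r ≤ m, p^r − 1 divides n − 1; consequently, n is a Carmichael number of order m, i.e., the map x ↦ x^n is a ring endomorphism of every commutative Z/nZ-algebra that can be generated as a Z/nZ-module by m elements. -/
open Polynomial in
lemma X_pow_sub_X_dvd_of_sub_one_dvd {R : Type*} [CommRing R] {a b : ℕ} (ha : 0 < a) (hb : 0 < b)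
    (h : a - 1 ∣ b - 1) : (X ^ a - X : R[X]) ∣ X ^ b - X := by
  have key : ∀ c : ℕ, 0 < c → (X ^ c - X : R[X]) = X * (X ^ (c - 1) - 1) := fun c hc => by
    rw [mul_sub, mul_one, ← pow_succ', Nat.sub_add_cancel hc]
  rw [key a ha, key b hb]
  obtain ⟨c, hc⟩ := h
  rw [hc]
  exact mul_dvd_mul_left _ (pow_one_sub_dvd_pow_mul_sub_one _ _ _)

open Polynomial in
lemma Polynomial.dvd_pow_natDegree_of_forall_irreducible_dvd {K : Type*} [Field K] {h : K[X]}
    (f : K[X]) (hf : f ≠ 0) (hirr : ∀ g : K[X], Irreducible g → g ∣ f → g ∣ h) :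
    f ∣ h ^ f.natDegree := by
  induction f using WfDvdMonoid.induction_on_irreducible with
  | zero => exact absurd rfl hf
  | unit u hu => exact hu.dvd
  | mul a i ha hi ih =>
    have h1 : i ∣ h := hirr i hi (dvd_mul_right i a)
    have h2 := ih ha fun g hg hga => hirr g hg (hga.mul_left i)
    rw [natDegree_mul hi.ne_zero ha, pow_add]
    exact mul_dvd_mul (h1.trans (dvd_pow_self h hi.natDegree_pos.ne')) h2

open Polynomial in
lemma ZMod.dvd_X_pow_sub_X_pow_of_natDegree_le {p m n : ℕ} [Fact p.Prime] (hmp : m ≤ p)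
    (hn : 0 < n) (hpn : p ∣ n) (hdvd : ∀ r, 1 ≤ r → r ≤ m → p ^ r - 1 ∣ n - 1)
    (f : (ZMod p)[X]) (hf : f ≠ 0) (hfm : f.natDegree ≤ m) :
    f ∣ X ^ n - X ^ p ^ m.factorial := by
  have hp : p.Prime := Fact.out
  obtain ⟨k, rfl⟩ := hpn
  obtain ⟨N, hN⟩ := Nat.exists_eq_succ_of_ne_zero m.factorial_ne_zero
  have hpow : (X ^ (p * k) - X ^ p ^ m.factorial : (ZMod p)[X])
      = (X ^ k - X ^ p ^ N) ^ p := by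
    rw [sub_pow_char, ← pow_mul, ← pow_mul, hN, mul_comm k, pow_succ]
  rw [hpow]
  refine (Polynomial.dvd_pow_natDegree_of_forall_irreducible_dvd (h := X ^ k - X ^ p ^ N) f hf
    fun g hg hgf => ?_).trans (pow_dvd_pow _ (hfm.trans hmp))
  refine hg.prime.dvd_of_dvd_pow (n := p) ?_
  rw [← hpow]
  have hgm : g.natDegree ≤ m := (natDegree_le_of_dvd hgf hf).trans hfm
  have hgX : g ∣ X ^ p ^ m.factorial - X := by
    have := (hg.natDegree_dvd_iff_dvd_X_pow_card_pow_sub_X (n := m.factorial)).1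
      (Nat.dvd_factorial hg.natDegree_pos hgm)
    simpa using this
  have hgX' : g ∣ X ^ p ^ g.natDegree - X := by
    have := (hg.natDegree_dvd_iff_dvd_X_pow_card_pow_sub_X (n := g.natDegree)).1 dvd_rfl
    simpa using this
  have := dvd_sub (hgX'.trans (X_pow_sub_X_dvd_of_sub_one_dvd (pow_pos hp.pos _) hn
    (hdvd _ hg.natDegree_pos hgm))) hgX
  simpa using this

lemma add_pow_eq_of_finrank_le {p m n : ℕ} [Fact p.Prime] (hmp : m ≤ p)
    (hn : 0 < n) (hpn : p ∣ n) (hdvd : ∀ r, 1 ≤ r → r ≤ m → p ^ r - 1 ∣ n - 1)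
    {B : Type*} [CommRing B] [Algebra (ZMod p) B] [Module.Finite (ZMod p) B]
    (hB : Module.finrank (ZMod p) B ≤ m) (x y : B) : (x + y) ^ n = x ^ n + y ^ n := by
  nontriviality B
  have : CharP B p := charP_of_injective_algebraMap (algebraMap (ZMod p) B).injective p
  have key : ∀ z : B, z ^ n = z ^ p ^ m.factorial := fun z => by
    have hz := ZMod.dvd_X_pow_sub_X_pow_of_natDegree_le hmp hn hpn hdvd (minpoly (ZMod p) z)
      (minpoly.ne_zero (Algebra.IsIntegral.isIntegral z)) ((minpoly.natDegree_le z).trans hB)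
    have := (minpoly.dvd_iff).1 hz
    simpa [sub_eq_zero] using this
  rw [key, key, key, add_pow_char_pow]

lemma lt_prime_of_forall_not_dvd_pow_sub_one {p q m : ℕ} (hp : p.Prime) (hq : q.Prime)
    (hpq : p ≠ q) (h : ∀ r, 1 ≤ r → r ≤ m → ¬ p ∣ q ^ r - 1) : m < p := by
  by_contra! hm
  have h2 := hp.two_le
  refine h (p - 1) (by omega) (by omega) ?_
  have hmod := Nat.ModEq.pow_totient ((Nat.coprime_primes hq hp).2 hpq.symm)
  rw [Nat.totient_prime hp] at hmod
  exact (Nat.modEq_iff_dvd' (Nat.one_le_pow _ _ hq.pos)).1 hmod.symm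

lemma Squarefree.eq_zero_of_forall_prime_mem_span {n : ℕ} (hsf : Squarefree n)
    {A : Type*} [CommRing A] (hA : (n : A) = 0) {z : A}
    (hz : ∀ p : ℕ, p.Prime → p ∣ n → z ∈ Ideal.span {(p : A)}) : z = 0 := by
  have hdvd : ∀ p : ℕ, p.Prime → p ∣ n → addOrderOf z ∣ n / p := fun p hp hpn => by
    obtain ⟨a, rfl⟩ := Ideal.mem_span_singleton'.1 (hz p hp hpn)
    rw [addOrderOf_dvd_iff_nsmul_eq_zero, nsmul_eq_mul, mul_comm a, ← mul_assoc, ← Nat.cast_mul,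
      Nat.div_mul_cancel hpn, hA, zero_mul]
  have hzn : addOrderOf z ∣ n := by
    rw [addOrderOf_dvd_iff_nsmul_eq_zero, nsmul_eq_mul, hA, zero_mul]
  rw [← AddMonoid.addOrderOf_eq_one_iff]
  by_contra hne
  obtain ⟨p, hp, hpz⟩ := Nat.exists_prime_and_dvd hne
  have hpn := hpz.trans hzn
  refine hp.not_isUnit (hsf p ?_)
  rw [← Nat.div_mul_cancel hpn]
  exact mul_dvd_mul_right (hpz.trans (hdvd p hp hpn)) p

lemma span_image_quotient_eq_top {n p : ℕ} [NeZero n] {A : Type*} [CommRing A]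
    [Algebra (ZMod n) A] (I : Ideal A) [Algebra (ZMod p) (A ⧸ I)] {s : Set A}
    (hs : Submodule.span (ZMod n) s = ⊤) :
    Submodule.span (ZMod p) (Ideal.Quotient.mk I '' s) = ⊤ := by
  rw [eq_top_iff]
  rintro b -
  obtain ⟨a, rfl⟩ := Ideal.Quotient.mk_surjective b
  have ha : a ∈ Submodule.span (ZMod n) s := hs ▸ Submodule.mem_top
  induction ha using Submodule.span_induction with
  | mem x hx => exact Submodule.subset_span (Set.mem_image_of_mem _ hx)
  | zero => simp
  | add x y _ _ hx hy => rw [map_add]; exact add_mem hx hy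
  | smul c x _ hx =>
    rw [← ZMod.natCast_zmod_val c, Nat.cast_smul_eq_nsmul, map_nsmul]
    exact nsmul_mem hx _


/-- Erdős-style construction: if `n > 1` is squarefree, composite, `n ≡ 1 (mod L)`, and
every prime divisor `p` of `n` satisfies `p ∤ L` and `p^r − 1 ∣ L` for `1 ≤ r ≤ m`, then
`p^r − 1 ∣ n − 1` for all such `p` and `r`, and `n` is a Carmichael number of order `m`
(i.e. `x ↦ x^n` is a ring endomorphism of every commutative `ZMod n`-algebra generated
as a `ZMod n`-module by `m` elements). -/
theorem stmt_8 (m L n : ℕ) (hm : 1 ≤ m) (hL : 0 < L) (hn : 1 < n)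
    (hsf : Squarefree n) (hcomp : ¬ n.Prime) (hmod : n ≡ 1 [MOD L])
    (hdiv : ∀ p : ℕ, p.Prime → p ∣ n →
      ¬ p ∣ L ∧ ∀ r : ℕ, 1 ≤ r → r ≤ m → p ^ r - 1 ∣ L) :
    (∀ p : ℕ, p.Prime → p ∣ n → ∀ r : ℕ, 1 ≤ r → r ≤ m → p ^ r - 1 ∣ n - 1) ∧
      (∀ (A : Type) [CommRing A] [Algebra (ZMod n) A],
        (∃ s : Finset A, s.card ≤ m ∧ Submodule.span (ZMod n) (s : Set A) = ⊤) →
        ∀ x y : A, (x + y) ^ n = x ^ n + y ^ n) := by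
  have hLn : L ∣ n - 1 := (Nat.modEq_iff_dvd' hn.le).1 hmod.symm
  have hdvd : ∀ p : ℕ, p.Prime → p ∣ n → ∀ r : ℕ, 1 ≤ r → r ≤ m → p ^ r - 1 ∣ n - 1 :=
    fun p hp hpn r h1 hr => ((hdiv p hp hpn).2 r h1 hr).trans hLn
  refine ⟨hdvd, fun A _ _ ⟨s, hs, hspan⟩ x y => ?_⟩
  have : NeZero n := ⟨by omega⟩
  have hnA : (n : A) = 0 := by
    rw [← map_natCast (algebraMap (ZMod n) A), ZMod.natCast_self, map_zero]
  rw [← sub_eq_zero]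
  refine hsf.eq_zero_of_forall_prime_mem_span hnA fun p hp hpn => ?_
  have hmp : m < p := by
    obtain ⟨k, rfl⟩ := hpn
    have hk : k ≠ 1 := fun hk => hcomp (by simpa [hk] using hp)
    obtain ⟨q, hq, hqk⟩ := Nat.exists_prime_and_dvd hk
    refine lt_prime_of_forall_not_dvd_pow_sub_one hp hq ?_ fun r h1 hr hpr =>
      (hdiv p hp (dvd_mul_right p k)).1
        (hpr.trans ((hdiv q hq (hqk.mul_left p)).2 r h1 hr))
    rintro rfl
    exact hp.not_isUnit (hsf p (mul_dvd_mul_left p hqk))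
  have : Fact p.Prime := ⟨hp⟩
  set I : Ideal A := Ideal.span {(p : A)}
  have hpI : (p : A ⧸ I) = 0 := by
    rw [← map_natCast (Ideal.Quotient.mk I)]
    exact Ideal.Quotient.eq_zero_iff_mem.2 (Ideal.mem_span_singleton_self _)
  obtain ⟨c, hc⟩ := CharP.exists (A ⧸ I)
  let _ : Algebra (ZMod p) (A ⧸ I) := ZMod.algebra' (A ⧸ I) c ((CharP.cast_eq_zero_iff _ c p).1 hpI)
  have hB := span_image_quotient_eq_top (p := p) I hspan
  classical
  rw [← Finset.coe_image] at hB
  have hfin : Module.Finite (ZMod p) (A ⧸ I) := ⟨⟨_, hB⟩⟩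
  have hrank : Module.finrank (ZMod p) (A ⧸ I) ≤ m := by
    rw [← finrank_top, ← hB]
    exact (finrank_span_finset_le_card _).trans (Finset.card_image_le.trans hs)
  rw [← Ideal.Quotient.eq_zero_iff_mem]
  simp only [map_sub, map_add, map_pow, sub_eq_zero]
  exact add_pow_eq_of_finrank_le hmp.le (by omega) hpn (hdvd p hp hpn) hrank _ _
end

section
/- Let m ≥ 1 and let n > 1 be a composite integer. Then the following are equivalent: (i) n is squarefree and for every prime p dividing n and every integer r with 1 ≤ r ≤ m, p^r − 1 divides n − 1; (ii) x^n = x for all x in Z/nZ, and for every prime p dividing n, every integer r with 1 ≤ r ≤ m, and every finite field F with p^r elements, x^n = x for all x in F. -/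
/-- Raising to a positive power `n` is the identity on a finite field `F` exactly when `#F - 1`
divides `n - 1`. -/
theorem FiniteField.forall_pow_eq_self_iff {F : Type*} [Field F] [Fintype F] {n : ℕ}
    (hn : 1 ≤ n) : (∀ x : F, x ^ n = x) ↔ Fintype.card F - 1 ∣ n - 1 := by
  obtain ⟨k, rfl⟩ := Nat.exists_eq_add_of_le' hn
  rw [Nat.add_sub_cancel, ← FiniteField.forall_pow_eq_one_iff F k]
  refine ⟨fun h u ↦ ?_, fun h x ↦ ?_⟩
  · have hu : u ^ (k + 1) = u := Units.ext (by simpa using h u)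
    simpa [pow_succ] using hu
  · rcases eq_or_ne x 0 with rfl | hx
    · simp
    · have hu := congrArg Units.val (h (Units.mk0 x hx))
      rw [Units.val_pow_eq_pow_val, Units.val_mk0, Units.val_one] at hu
      rw [pow_succ, hu, one_mul]

/-- A ring in which every element equals its own `n`-th power, for some `n ≥ 2`, is reduced. -/
theorem isReduced_of_forall_pow_eq_self {R : Type*} [MonoidWithZero R] {n : ℕ} (hn : 1 < n)
    (h : ∀ x : R, x ^ n = x) : IsReduced R := by
  refine ⟨fun x ⟨k, hk⟩ ↦ ?_⟩
  have hx : ∀ j : ℕ, x ^ n ^ j = x := fun j ↦ by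
    induction j with
    | zero => simp
    | succ j ih => rw [pow_succ, pow_mul, ih, h]
  rw [← hx k]
  exact pow_eq_zero_of_le (Nat.lt_pow_self hn).le hk

/-- A squarefree natural number divides an integer as soon as all its prime factors do. -/
theorem Squarefree.natCast_dvd_int_of_forall_prime {n : ℕ} (hn : Squarefree n) {a : ℤ}
    (h : ∀ p : ℕ, p.Prime → p ∣ n → (p : ℤ) ∣ a) : (n : ℤ) ∣ a := by
  rw [Int.natCast_dvd, ← Nat.prod_primeFactors_of_squarefree hn]
  refine Finset.prod_primes_dvd _ (fun p hp ↦ (Nat.prime_of_mem_primeFactors hp).prime)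
    fun p hp ↦ ?_
  exact Int.natCast_dvd.mp
    (h p (Nat.prime_of_mem_primeFactors hp) (Nat.dvd_of_mem_primeFactors hp))

/-- Characterization of rigid Carmichael numbers of order `m`: for composite `n > 1`,
`n` is squarefree with `p^r − 1 ∣ n − 1` for every prime `p ∣ n` and every `1 ≤ r ≤ m`
if and only if `x^n = x` on `ZMod n` and on every finite field of cardinality `p^r`
with `p ∣ n` prime and `1 ≤ r ≤ m`. -/
theorem stmt_9 (m n : ℕ) (hm : 1 ≤ m) (hn : 1 < n) (hcomp : ¬ n.Prime) :
    (Squarefree n ∧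
      ∀ p : ℕ, p.Prime → p ∣ n → ∀ r : ℕ, 1 ≤ r → r ≤ m → p ^ r - 1 ∣ n - 1)
      ↔
    ((∀ x : ZMod n, x ^ n = x) ∧
      ∀ p : ℕ, p.Prime → p ∣ n → ∀ r : ℕ, 1 ≤ r → r ≤ m →
        ∀ (F : Type) [Field F] [Fintype F], Fintype.card F = p ^ r →
          ∀ x : F, x ^ n = x) := by
  have hn1 : 1 ≤ n := hn.le
  constructor
  · rintro ⟨hsq, hdvd⟩
    refine ⟨fun x ↦ ?_, fun p hp hpn r hr hrm F _ _ hF ↦ ?_⟩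
    · obtain ⟨a, rfl⟩ := ZMod.intCast_surjective x
      rw [← sub_eq_zero, ← Int.cast_pow, ← Int.cast_sub, ZMod.intCast_zmod_eq_zero_iff_dvd]
      refine hsq.natCast_dvd_int_of_forall_prime fun p hp hpn ↦ ?_
      have : Fact p.Prime := ⟨hp⟩
      rw [← ZMod.intCast_zmod_eq_zero_iff_dvd, Int.cast_sub, Int.cast_pow, sub_eq_zero]
      refine (FiniteField.forall_pow_eq_self_iff hn1).mpr ?_ _
      simpa [ZMod.card] using hdvd p hp hpn 1 le_rfl hm
    · rw [FiniteField.forall_pow_eq_self_iff hn1, hF]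
      exact hdvd p hp hpn r hr hrm
  · rintro ⟨hZ, hF⟩
    refine ⟨?_, fun p hp hpn r hr hrm ↦ ?_⟩
    · exact (isReduced_zmod.mp (isReduced_of_forall_pow_eq_self hn hZ)).resolve_right (by omega)
    · have : Fact p.Prime := ⟨hp⟩
      have : Fintype (GaloisField p r) := Fintype.ofFinite _
      have hcard : Fintype.card (GaloisField p r) = p ^ r := by
        rw [← Nat.card_eq_fintype_card, GaloisField.card p r (by omega)]
      rw [← hcard, ← FiniteField.forall_pow_eq_self_iff hn1]
      exact hF p hp hpn r hr hrm _ hcard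
end

section
/- Let p₀ be a prime and let n₀ > 1 be a squarefree integer not divisible by p₀ such that: (i) n₀ ≡ 1 (mod p₀² − 1), and (ii) for every prime divisor p of n₀, both p − 1 and p² − 1 divide p₀·n₀ − 1. Set n = p₀·n₀. Then n is squarefree and composite, n ≡ p₀ (mod p₀² − 1), for every prime divisor p of n₀ and every r ∈ {1, 2} one has n ≡ 1 (mod p^r − 1), and p₀² − 1 does not divide n − 1. Consequently n is a Carmichael number of order 2 that is not a rigid Carmichael number of order 2. -/
/-- A nilpotent element of an algebra of dimension at most `d` has vanishing `d`-th power. -/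
theorem IsNilpotent.pow_eq_zero_of_finrank_le {K B : Type*} [Field K] [CommRing B] [Algebra K B]
    [Module.Finite K B] {d : ℕ} (hd : Module.finrank K B ≤ d) {u : B} (hu : IsNilpotent u) :
    u ^ d = 0 := by
  have hmul : IsNilpotent (LinearMap.mulLeft K u) := by
    obtain ⟨k, hk⟩ := hu
    exact ⟨k, by rw [LinearMap.pow_mulLeft, hk, LinearMap.mulLeft_zero_eq_zero]⟩
  have hpow : LinearMap.mulLeft K u ^ Module.finrank K B = 0 := by
    have h := (LinearMap.mulLeft K u).aeval_self_charpoly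
    rwa [hmul.charpoly_eq_X_pow_finrank, map_pow, Polynomial.aeval_X] at h
  refine pow_eq_zero_of_le hd ?_
  simpa [LinearMap.pow_mulLeft] using LinearMap.congr_fun hpow 1

/-- In an `𝔽_p`-algebra of dimension at most `2`, every `p`-th power is fixed by the square of
the Frobenius map. -/
theorem pow_prime_pow_sq_eq {p : ℕ} [Fact p.Prime] {B : Type*} [CommRing B]
    [Algebra (ZMod p) B] [Module.Finite (ZMod p) B] (hB : Module.finrank (ZMod p) B ≤ 2) (x : B) :
    (x ^ p) ^ p ^ 2 = x ^ p := by
  nontriviality B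
  have hp : p.Prime := Fact.out
  have : CharP B p := charP_of_injective_algebraMap (algebraMap (ZMod p) B).injective p
  have hfin : Finite B := Module.finite_of_finite (ZMod p)
  have hnil : IsNilpotent (x ^ p ^ 2 - x) := by
    rw [← mem_nilradical, nilradical_eq_sInf, Submodule.mem_sInf]
    intro P (hP : Ideal.IsPrime P)
    rw [← Ideal.Quotient.eq_zero_iff_mem, map_sub, map_pow, sub_eq_zero]
    generalize Ideal.Quotient.mk P x = y
    have : Finite (B ⧸ P) := Finite.of_surjective _ Ideal.Quotient.mk_surjective
    have : Fintype (B ⧸ P) := Fintype.ofFinite _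
    have hcard : Fintype.card (B ⧸ P) = p ^ Module.finrank (ZMod p) (B ⧸ P) := by
      rw [Module.card_eq_pow_finrank (K := ZMod p), ZMod.card]
    have hle : Module.finrank (ZMod p) (B ⧸ P) ≤ 2 :=
      (LinearMap.finrank_le_finrank_of_surjective (f := (Ideal.Quotient.mkₐ (ZMod p) P).toLinearMap)
        Ideal.Quotient.mk_surjective).trans hB
    have hpos : 0 < Module.finrank (ZMod p) (B ⧸ P) := Module.finrank_pos
    let : Field (B ⧸ P) := (Finite.isField_of_domain (B ⧸ P)).toField
    have hy : y ^ p ^ Module.finrank (ZMod p) (B ⧸ P) = y := by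
      rw [← hcard]
      exact FiniteField.pow_card y
    generalize Module.finrank (ZMod p) (B ⧸ P) = d at hle hpos hy
    interval_cases d
    · rw [pow_one] at hy
      rw [sq, pow_mul, hy, hy]
    · exact hy
  have h := pow_eq_zero_of_le hp.two_le (hnil.pow_eq_zero_of_finrank_le hB)
  rwa [sub_pow_char, sub_eq_zero, pow_right_comm] at h

/-- If `y ^ q = y`, then positive powers of `y` depend only on the exponent modulo `q - 1`. -/
theorem pow_eq_pow_of_pow_eq_self {M : Type*} [Monoid M] {y : M} {q a b : ℕ} (hq : 0 < q)
    (hy : y ^ q = y) (ha : 0 < a) (hb : 0 < b) (hab : a ≡ b [MOD q - 1]) : y ^ a = y ^ b := by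
  have key : ∀ c k, 0 < c → y ^ (c + (q - 1) * k) = y ^ c := by
    intro c k hc
    induction k with
    | zero => simp
    | succ k ih =>
      rw [show c + (q - 1) * (k + 1) = (c - 1 + (q - 1) * k) + q by
        rw [mul_add]; omega, pow_add, hy, ← pow_succ, ← ih]
      congr 1
      omega
  wlog hle : a ≤ b generalizing a b
  · exact (this hb ha hab.symm (by omega)).symm
  obtain ⟨k, hk⟩ := (Nat.modEq_iff_dvd' hle).1 hab
  rw [show b = a + (q - 1) * k by omega, key a k ha]

/-- If `m` is congruent to `1` or `p` modulo `p² - 1`, then raising to the power `p * m` is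
additive on every `𝔽_p`-algebra of dimension at most `2`. -/
theorem add_pow_prime_mul_of_modEq {p m : ℕ} [Fact p.Prime] {B : Type*} [CommRing B]
    [Algebra (ZMod p) B] [Module.Finite (ZMod p) B] (hB : Module.finrank (ZMod p) B ≤ 2)
    (hm : 0 < m) (h : m ≡ 1 [MOD p ^ 2 - 1] ∨ m ≡ p [MOD p ^ 2 - 1]) (x y : B) :
    (x + y) ^ (p * m) = x ^ (p * m) + y ^ (p * m) := by
  nontriviality B
  have hp : p.Prime := Fact.out
  have : CharP B p := charP_of_injective_algebraMap (algebraMap (ZMod p) B).injective p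
  have hq : 0 < p ^ 2 := pow_pos hp.pos 2
  obtain h | h := h
  · have key : ∀ z : B, z ^ (p * m) = z ^ p := fun z => by
      rw [pow_mul, pow_eq_pow_of_pow_eq_self hq (pow_prime_pow_sq_eq hB z) hm one_pos h, pow_one]
    simp only [key, add_pow_char]
  · have key : ∀ z : B, z ^ (p * m) = (z ^ p) ^ p := fun z => by
      rw [pow_mul, pow_eq_pow_of_pow_eq_self hq (pow_prime_pow_sq_eq hB z) hm hp.pos h]
    simp only [key, add_pow_char]

/-- If `m` is congruent to `1` or `p` modulo `p² - 1`, then raising to the power `p * m` is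
additive modulo `p` on every algebra generated as a module by at most `2` elements. -/
theorem add_pow_sub_mem_span_prime {n p m : ℕ} (hp : p.Prime) (hm : 0 < m)
    (h : m ≡ 1 [MOD p ^ 2 - 1] ∨ m ≡ p [MOD p ^ 2 - 1]) {A : Type*} [CommRing A]
    [Algebra (ZMod n) A] (hA : ∃ s : Finset A, s.card ≤ 2 ∧
      Submodule.span (ZMod n) (s : Set A) = ⊤) (x y : A) :
    (x + y) ^ (p * m) - (x ^ (p * m) + y ^ (p * m)) ∈ Ideal.span {(p : A)} := by
  classical
  obtain ⟨s, hs, hspan⟩ := hA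
  have : Fact p.Prime := ⟨hp⟩
  rw [← Ideal.Quotient.eq_zero_iff_mem]
  let f := Ideal.Quotient.mk (Ideal.span {(p : A)})
  change f _ = 0
  nontriviality A ⧸ Ideal.span {(p : A)}
  have hp0 : (p : A ⧸ Ideal.span {(p : A)}) = 0 := by
    rw [← map_natCast f]
    exact Ideal.Quotient.eq_zero_iff_mem.2 (Ideal.mem_span_singleton_self _)
  have : CharP (A ⧸ Ideal.span {(p : A)}) p := (CharP.charP_iff_prime_eq_zero hp).2 hp0
  let : Algebra (ZMod p) (A ⧸ Ideal.span {(p : A)}) := ZMod.algebra _ p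
  have htop : Submodule.span (ZMod p) ((s.image f : Finset _) : Set (A ⧸ Ideal.span {(p : A)}))
      = ⊤ := by
    rw [eq_top_iff]
    rintro b -
    obtain ⟨a, rfl⟩ := Ideal.Quotient.mk_surjective b
    have ha : a ∈ Submodule.span (ZMod n) (s : Set A) := hspan ▸ Submodule.mem_top
    induction ha using Submodule.span_induction with
    | mem a ha => exact Submodule.subset_span (Finset.mem_coe.2 (Finset.mem_image_of_mem f ha))
    | zero => rw [map_zero]; exact Submodule.zero_mem _
    | add a b _ _ iha ihb => rw [map_add]; exact Submodule.add_mem _ iha ihb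
    | smul c a _ iha =>
      obtain ⟨k, rfl⟩ := ZMod.intCast_surjective c
      rw [Int.cast_smul_eq_zsmul, map_zsmul]
      exact zsmul_mem iha k
  have : Module.Finite (ZMod p) (A ⧸ Ideal.span {(p : A)}) := ⟨⟨_, htop⟩⟩
  have hrank : Module.finrank (ZMod p) (A ⧸ Ideal.span {(p : A)}) ≤ 2 := by
    rw [← finrank_top, ← htop]
    exact (finrank_span_finset_le_card _).trans (Finset.card_image_le.trans hs)
  simp only [map_sub, map_add, map_pow, add_pow_prime_mul_of_modEq hrank hm h, sub_self]

/-- If `n` is squarefree and kills the ring `A`, then the ideals `pA`, for `p` a prime divisor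
of `n`, have trivial intersection. -/
theorem eq_zero_of_forall_mem_span_prime {n : ℕ} (hn : Squarefree n) {A : Type*} [CommRing A]
    (hnA : (n : A) = 0) {d : A}
    (hd : ∀ p : ℕ, p.Prime → p ∣ n → d ∈ Ideal.span {(p : A)}) : d = 0 := by
  rw [← AddMonoid.addOrderOf_eq_one_iff]
  by_contra hne
  obtain ⟨q, hq, hqd⟩ := Nat.exists_prime_and_dvd hne
  have hqn : q ∣ n := hqd.trans
    (addOrderOf_dvd_of_nsmul_eq_zero (by rw [nsmul_eq_mul, hnA, zero_mul]))
  obtain ⟨k, rfl⟩ := hqn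
  obtain ⟨e, rfl⟩ := Ideal.mem_span_singleton'.1 (hd q hq (dvd_mul_right q k))
  have hk : addOrderOf (e * (q : A)) ∣ k := addOrderOf_dvd_of_nsmul_eq_zero (by
    push_cast at hnA
    rw [nsmul_eq_mul]
    linear_combination e * hnA)
  exact hq.not_isUnit (hn q (mul_dvd_mul_left q (hqd.trans hk)))


/-- Construction of non-rigid Carmichael numbers of order 2 (Section 5).  If `p₀` is
prime, `n₀ > 1` is squarefree with `p₀ ∤ n₀`, `n₀ ≡ 1 (mod p₀² − 1)`, and every prime
`p ∣ n₀` satisfies `p − 1 ∣ p₀·n₀ − 1` and `p² − 1 ∣ p₀·n₀ − 1`, then `n = p₀·n₀` is a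
squarefree composite number with `n ≡ p₀ (mod p₀² − 1)`, with `p^r − 1 ∣ n − 1` for every
prime `p ∣ n₀` and `r ∈ {1, 2}`, and `p₀² − 1 ∤ n − 1`.  Consequently `n` is a Carmichael
number of order 2 (the endomorphism property holds) but not a rigid one. -/
theorem stmt_10 (p₀ n₀ : ℕ) (hp₀ : p₀.Prime) (hn₀ : 1 < n₀) (hsf₀ : Squarefree n₀)
    (hnd : ¬ p₀ ∣ n₀) (h1 : n₀ ≡ 1 [MOD p₀ ^ 2 - 1])
    (h2 : ∀ p : ℕ, p.Prime → p ∣ n₀ →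
      (p - 1 ∣ p₀ * n₀ - 1) ∧ (p ^ 2 - 1 ∣ p₀ * n₀ - 1)) :
    Squarefree (p₀ * n₀) ∧ 1 < p₀ * n₀ ∧ ¬ (p₀ * n₀).Prime ∧
      p₀ * n₀ ≡ p₀ [MOD p₀ ^ 2 - 1] ∧
      (∀ p : ℕ, p.Prime → p ∣ n₀ → ∀ r : ℕ, 1 ≤ r → r ≤ 2 →
        p ^ r - 1 ∣ p₀ * n₀ - 1) ∧
      ¬ (p₀ ^ 2 - 1 ∣ p₀ * n₀ - 1) ∧
      (∀ (A : Type) [CommRing A] [Algebra (ZMod (p₀ * n₀)) A],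
        (∃ s : Finset A, s.card ≤ 2 ∧
          Submodule.span (ZMod (p₀ * n₀)) (s : Set A) = ⊤) →
        ∀ x y : A, (x + y) ^ (p₀ * n₀) = x ^ (p₀ * n₀) + y ^ (p₀ * n₀)) ∧
      ¬ (∀ p : ℕ, p.Prime → p ∣ p₀ * n₀ → ∀ r : ℕ, 1 ≤ r → r ≤ 2 →
          p ^ r - 1 ∣ p₀ * n₀ - 1) := by
  have hsq : p₀ + 1 < p₀ ^ 2 := by nlinarith [hp₀.two_le]
  have hsf : Squarefree (p₀ * n₀) :=
    Nat.squarefree_mul_iff.2 ⟨(hp₀.coprime_iff_not_dvd).2 hnd, hp₀.squarefree, hsf₀⟩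
  have hpos : 0 < p₀ * n₀ := Nat.mul_pos hp₀.pos (by omega)
  have hmod : p₀ * n₀ ≡ p₀ [MOD p₀ ^ 2 - 1] := by simpa using h1.mul_left p₀
  have hr : ∀ p : ℕ, p.Prime → p ∣ n₀ → ∀ r : ℕ, 1 ≤ r → r ≤ 2 →
      p ^ r - 1 ∣ p₀ * n₀ - 1 := by
    intro p hp hpn r hr1 hr2
    interval_cases r
    · simpa using (h2 p hp hpn).1
    · exact (h2 p hp hpn).2
  have hnot : ¬ (p₀ ^ 2 - 1 ∣ p₀ * n₀ - 1) := by
    intro h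
    have h' : 1 ≡ p₀ [MOD p₀ ^ 2 - 1] := ((Nat.modEq_iff_dvd' hpos).2 h).trans hmod
    have := Nat.le_of_dvd (by have := hp₀.two_le; omega)
      ((Nat.modEq_iff_dvd' hp₀.one_le).1 h')
    have := hp₀.two_le
    omega
  refine ⟨hsf, by nlinarith [hp₀.two_le], Nat.not_prime_mul hp₀.ne_one hn₀.ne', hmod, hr, hnot,
    ?_, fun h => hnot (h p₀ hp₀ (dvd_mul_right _ _) 2 one_le_two le_rfl)⟩
  intro A _ _ hA x y
  have hnA : ((p₀ * n₀ : ℕ) : A) = 0 := by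
    rw [← map_natCast (algebraMap (ZMod (p₀ * n₀)) A), ZMod.natCast_self, map_zero]
  rw [← sub_eq_zero]
  refine eq_zero_of_forall_mem_span_prime hsf hnA fun p hp hpn => ?_
  obtain rfl | hne := eq_or_ne p p₀
  · exact add_pow_sub_mem_span_prime hp (by omega) (.inl h1) hA x y
  · have hpn₀ : p ∣ n₀ :=
      (hp.dvd_mul.1 hpn).resolve_left fun h => hne ((Nat.prime_dvd_prime_iff_eq hp hp₀).1 h)
    obtain ⟨m, hm⟩ := hpn
    have hm0 : 0 < m := Nat.pos_of_mul_pos_left (hm ▸ hpos)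
    have hpm : 1 ≡ p * m [MOD p ^ 2 - 1] :=
      hm ▸ (Nat.modEq_iff_dvd' hpos).2 (h2 p hp hpn₀).2
    have hpp : 1 ≡ p ^ 2 [MOD p ^ 2 - 1] :=
      (Nat.modEq_iff_dvd' (Nat.one_le_pow _ _ hp.pos)).2 dvd_rfl
    have hmp : m ≡ p [MOD p ^ 2 - 1] :=
      calc m = 1 * m := (one_mul m).symm
        _ ≡ p ^ 2 * m [MOD p ^ 2 - 1] := hpp.mul_right m
        _ = p * (p * m) := by ring
        _ ≡ p * 1 [MOD p ^ 2 - 1] := hpm.symm.mul_left p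
        _ = p := mul_one p
    have h := add_pow_sub_mem_span_prime hp hm0 (.inr hmp) hA x y
    rwa [← hm] at h
end

section
/- Let m be a positive integer and let n be a composite squarefree integer such that for every prime p dividing n and every integer r with 1 ≤ r ≤ m there exists an integer i ≥ 0 with n ≡ p^i (mod p^r − 1). Let K be a number field of degree at most m over Q and let α be an element of the ring of integers O_K. Then n divides Tr_{K/Q}(α^n) − Tr_{K/Q}(α), where Tr_{K/Q} denotes the trace from O_K to Z. -/
open NumberField

open Polynomial in
/-- If `n` is congruent to a power of `p` modulo `p ^ deg g - 1`, then summing the `n`-th powers of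
the roots of an irreducible polynomial `g` over `𝔽_p` gives the sum of the roots. -/
theorem Irreducible.sum_aroots_pow_eq_sum_aroots {p : ℕ} [Fact p.Prime] {k : Type*} [Field k]
    [Algebra (ZMod p) k] {g : (ZMod p)[X]} (hg : Irreducible g)
    (hs : (g.map (algebraMap (ZMod p) k)).Splits) {n i : ℕ} (hn : 0 < n)
    (hni : n ≡ p ^ i [MOD p ^ g.natDegree - 1]) :
    ((g.aroots k).map (· ^ n)).sum = (g.aroots k).sum := by
  have : CharP k p := charP_of_injective_algebraMap (algebraMap (ZMod p) k).injective p
  have hp : p.Prime := Fact.out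
  have hpow : ∀ x ∈ g.aroots k, x ^ n = x ^ p ^ i := by
    intro x hx
    rcases eq_or_ne x 0 with rfl | hx0
    · rw [zero_pow hn.ne', zero_pow (pow_ne_zero _ hp.ne_zero)]
    have hroot : aeval x g = 0 := (mem_aroots.mp hx).2
    have hdvd := hg.natDegree_dvd_iff_dvd_X_pow_card_pow_sub_X.mp dvd_rfl
    rw [Nat.card_zmod] at hdvd
    have hfix := aeval_eq_zero_of_dvd_aeval_eq_zero hdvd hroot
    rw [map_sub, map_pow, aeval_X, sub_eq_zero] at hfix
    have hone : x ^ (p ^ g.natDegree - 1) = 1 := by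
      apply mul_right_cancel₀ hx0
      rw [← pow_succ, Nat.sub_add_cancel (Nat.one_le_pow _ _ hp.pos), hfix, one_mul]
    have hunit : Units.mk0 x hx0 ^ (p ^ g.natDegree - 1) = 1 := Units.ext (by simpa using hone)
    simpa using congrArg Units.val
      (pow_eq_pow_iff_modEq.mpr (hni.of_dvd (orderOf_dvd_of_pow_eq_one hunit)))
  rw [Multiset.map_congr rfl hpow, ← multiset_sum_pow_char_pow]
  obtain ⟨c, hc⟩ : ∃ c : ZMod p, algebraMap (ZMod p) k c = (g.aroots k).sum := by
    have h := hs.nextCoeff_eq_neg_sum_roots_mul_leadingCoeff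
    rw [nextCoeff_map (algebraMap (ZMod p) k).injective, leadingCoeff_map] at h
    have hlc : algebraMap (ZMod p) k g.leadingCoeff ≠ 0 := by simpa using hg.ne_zero
    refine ⟨-g.nextCoeff / g.leadingCoeff, ?_⟩
    rw [map_div₀, map_neg, h, aroots_def]
    field_simp
  rw [← hc, ← map_pow, ZMod.pow_card_pow]

open Polynomial in
/-- If `n` is congruent to a power of `p` modulo `p ^ r - 1` for all `1 ≤ r ≤ m`, then summing the
`n`-th powers of the roots of a polynomial over `𝔽_p` of degree at most `m` gives the sum of the
roots. -/
theorem Polynomial.sum_aroots_pow_eq_sum_aroots {p : ℕ} [Fact p.Prime] {k : Type*} [Field k]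
    [Algebra (ZMod p) k] {m n : ℕ} (hn : 0 < n)
    (hcong : ∀ r : ℕ, 1 ≤ r → r ≤ m → ∃ i : ℕ, n ≡ p ^ i [MOD p ^ r - 1])
    (g : (ZMod p)[X]) (hdeg : g.natDegree ≤ m) (hs : (g.map (algebraMap (ZMod p) k)).Splits) :
    ((g.aroots k).map (· ^ n)).sum = (g.aroots k).sum := by
  induction g using WfDvdMonoid.induction_on_irreducible with
  | zero => simp
  | unit u hu =>
    rw [eq_C_of_natDegree_eq_zero (natDegree_eq_zero_of_isUnit hu), aroots_C]
    simp
  | mul a q ha hq ih =>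
    have hqa : q * a ≠ 0 := mul_ne_zero hq.ne_zero ha
    rw [natDegree_mul hq.ne_zero ha] at hdeg
    rw [Polynomial.map_mul, splits_mul (by simpa using hq.ne_zero) (by simpa using ha)] at hs
    obtain ⟨i, hi⟩ := hcong q.natDegree hq.natDegree_pos (by omega)
    rw [aroots_mul hqa, Multiset.map_add, Multiset.sum_add, Multiset.sum_add,
      ih (by omega) hs.2, hq.sum_aroots_pow_eq_sum_aroots hs.1 hn hi]

open IntermediateField in
/-- Power sums of the conjugates of `x` compute the traces of its powers. -/
theorem Algebra.trace_pow_eq_finrank_smul_sum_aroots_pow {F L : Type*} (E : Type*) [Field F]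
    [Field L] [Field E] [Algebra F L] [Algebra F E] [FiniteDimensional F L]
    [Algebra.IsSeparable F L] [IsAlgClosed E] (x : L) (n : ℕ) :
    algebraMap F E (Algebra.trace F L (x ^ n)) =
      Module.finrank F⟮x⟯ L • (((minpoly F x).aroots E).map (· ^ n)).sum := by
  classical
  have hx : IsIntegral F x := Algebra.IsIntegral.isIntegral x
  let pb := IntermediateField.adjoin.powerBasis hx
  have hgen : pb.gen = AdjoinSimple.gen F x := IntermediateField.adjoin.powerBasis_gen hx
  have hpow : x ^ n = algebraMap F⟮x⟯ L (pb.gen ^ n) := by simp [hgen]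
  have hmin : minpoly F pb.gen = minpoly F x := by rw [hgen, minpoly_gen]
  rw [hpow, ← Algebra.trace_trace (S := F⟮x⟯), Algebra.trace_algebraMap, map_nsmul, map_nsmul,
    trace_eq_sum_embeddings E, ← hmin]
  congr 1
  have hnodup : ((minpoly F pb.gen).aroots E).Nodup :=
    Polynomial.nodup_roots (Polynomial.Separable.map (Algebra.IsSeparable.isSeparable F pb.gen))
  rw [← Multiset.dedup_eq_self.mpr hnodup, ← Multiset.toFinset_val]
  change _ = ∑ y ∈ _, y ^ n
  rw [← Finset.sum_coe_sort ((minpoly F pb.gen).aroots E).toFinset]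
  refine Fintype.sum_equiv (pb.liftEquiv'.trans (Equiv.subtypeEquivRight fun y => by
    rw [Multiset.mem_toFinset])) _ _ fun σ => ?_
  exact map_pow σ pb.gen n

/-- If `n` is congruent to a power of `p` modulo `p ^ r - 1` for all `1 ≤ r ≤ m`, then `α ^ n` and
`α` have the same trace modulo `p` in a number field of degree at most `m`. -/
theorem NumberField.prime_dvd_trace_pow_sub_trace {p m n : ℕ} (hp : p.Prime) (hn : 0 < n)
    (hcong : ∀ r : ℕ, 1 ≤ r → r ≤ m → ∃ i : ℕ, n ≡ p ^ i [MOD p ^ r - 1])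
    {K : Type*} [Field K] [NumberField K] (hdeg : Module.finrank ℚ K ≤ m) (α : 𝓞 K) :
    (p : ℤ) ∣ Algebra.trace ℤ (𝓞 K) (α ^ n) - Algebra.trace ℤ (𝓞 K) α := by
  have : Fact p.Prime := ⟨hp⟩
  let E := AlgebraicClosure ℚ
  let O := integralClosure ℤ E
  obtain ⟨P, hP, hPp⟩ := Ideal.exists_ideal_over_maximal_of_isIntegral (R := ℤ) (S := O)
    (Ideal.span {(p : ℤ)}) (P_max := Int.ideal_span_isMaximal_of_prime p) (by
      rw [(RingHom.injective_iff_ker_eq_bot _).mp (FaithfulSMul.algebraMap_injective ℤ O)]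
      exact bot_le)
  let : Field (O ⧸ P) := Ideal.Quotient.field P
  have key : ∀ z : ℤ, (z : O ⧸ P) = 0 ↔ (p : ℤ) ∣ z := by
    intro z
    rw [← Ideal.mem_span_singleton, ← hPp, Ideal.mem_comap, ← Ideal.Quotient.eq_zero_iff_mem]
    simp
  have : CharP (O ⧸ P) p := ⟨fun z => by simpa [Int.natCast_dvd_natCast] using key z⟩
  let : Algebra (ZMod p) (O ⧸ P) := ZMod.algebra _ p
  have hα : IsIntegral ℤ α := Algebra.IsIntegral.isIntegral α
  set f := minpoly ℤ α with hf
  have hmonic : f.Monic := minpoly.monic hα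
  have hfQ : minpoly ℚ (α : K) = f.map (algebraMap ℤ ℚ) := by
    rw [minpoly.isIntegrallyClosed_eq_field_fractions' ℚ (RingOfIntegers.isIntegral_coe α),
      hf, ← minpoly.algebraMap_eq (B' := K) RingOfIntegers.coe_injective α]
  have hfE : (f.map (algebraMap ℤ O)).map (algebraMap O E) =
      (minpoly ℚ (α : K)).map (algebraMap ℚ E) := by
    rw [hfQ, Polynomial.map_map, Polynomial.map_map, RingHom.ext_int (RingHom.comp _ _)]
  have hsO : (f.map (algebraMap ℤ O)).Splits := by
    apply Polynomial.Splits.of_splits_map_of_injective (i := algebraMap O E)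
      Subtype.val_injective (IsAlgClosed.splits _)
    intro a ha
    refine ⟨⟨a, f, hmonic, ?_⟩, rfl⟩
    rw [Polynomial.map_map, RingHom.ext_int (RingHom.comp _ _) (algebraMap ℤ E)] at ha
    exact Polynomial.eval_map (algebraMap ℤ E) a ▸ Polynomial.isRoot_of_mem_roots ha
  have hbar : (f.map (algebraMap ℤ O)).map (Ideal.Quotient.mk P) =
      (f.map (Int.castRingHom (ZMod p))).map (algebraMap (ZMod p) (O ⧸ P)) := by
    rw [Polynomial.map_map, Polynomial.map_map]
    congr 1
    exact RingHom.ext_int _ _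
  set S := (f.map (algebraMap ℤ O)).roots with hS
  have hSE : (minpoly ℚ (α : K)).aroots E = S.map (algebraMap O E) := by
    rw [Polynomial.aroots_def, ← hfE, hsO.roots_map_of_injective Subtype.val_injective]
  have hSk : (f.map (Int.castRingHom (ZMod p))).aroots (O ⧸ P) = S.map (Ideal.Quotient.mk P) := by
    rw [Polynomial.aroots_def, ← hbar, hsO.roots_map_of_ne_zero]
    exact ((hmonic.map _).map _).ne_zero
  have hfdeg : (f.map (Int.castRingHom (ZMod p))).natDegree ≤ m := by
    rw [hmonic.natDegree_map]
    have := minpoly.natDegree_le (A := ℚ) (α : K)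
    rw [hfQ, hmonic.natDegree_map] at this
    omega
  have hsum := Polynomial.sum_aroots_pow_eq_sum_aroots (k := O ⧸ P) hn hcong _ hfdeg
    (hbar ▸ hsO.map _)
  have htr : ∀ j : ℕ, ((Algebra.trace ℤ (𝓞 K) (α ^ j) : ℤ) : O) =
      Module.finrank (IntermediateField.adjoin ℚ {(α : K)}) K • (S.map (· ^ j)).sum := by
    intro j
    apply FaithfulSMul.algebraMap_injective O E
    have h := Algebra.trace_pow_eq_finrank_smul_sum_aroots_pow (F := ℚ) E (α : K) j
    rw [← map_pow, ← Algebra.coe_trace_int, hSE] at h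
    rw [map_nsmul, map_multiset_sum, Multiset.map_map]
    simpa [Multiset.map_map, Function.comp_def] using h
  rw [← key]
  have h1 := congrArg (Ideal.Quotient.mk P) (htr 1)
  have h2 := congrArg (Ideal.Quotient.mk P) (htr n)
  rw [map_intCast, map_nsmul, map_multiset_sum, Multiset.map_map] at h1 h2
  rw [hSk, Multiset.map_map] at hsum
  simp only [Function.comp_def, map_pow, pow_one] at h1 h2 hsum
  rw [Int.cast_sub, h1, h2, hsum, sub_self]

/-- Carmichael numbers of order `m` pass Dickson-like trace tests: if `n` satisfies
condition (c) of the main theorem for order `m`, `K` is a number field of degree at most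
`m`, and `α` is an algebraic integer of `K`, then
`Tr_{K/ℚ}(α^n) ≡ Tr_{K/ℚ}(α) (mod n)`. -/
theorem stmt_12 (m n : ℕ) (hm : 0 < m) (hn : 1 < n) (hcomp : ¬ n.Prime)
    (hsf : Squarefree n)
    (hcong : ∀ p : ℕ, p.Prime → p ∣ n → ∀ r : ℕ, 1 ≤ r → r ≤ m →
      ∃ i : ℕ, n ≡ p ^ i [MOD p ^ r - 1])
    (K : Type) [Field K] [NumberField K] (hdeg : Module.finrank ℚ K ≤ m)
    (α : 𝓞 K) :
    (n : ℤ) ∣ Algebra.trace ℤ (𝓞 K) (α ^ n) - Algebra.trace ℤ (𝓞 K) α := by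
  rw [Int.natCast_dvd]
  refine (Nat.prod_primeFactors_of_squarefree hsf).symm.dvd.trans ?_
  refine Finset.prod_primes_dvd _ (fun p hp => (Nat.prime_of_mem_primeFactors hp).prime)
    fun p hp => ?_
  have hp' := Nat.prime_of_mem_primeFactors hp
  exact Int.natCast_dvd.mp <| NumberField.prime_dvd_trace_pow_sub_trace hp' (by omega)
    (hcong p hp' (Nat.dvd_of_mem_primeFactors hp)) hdeg α
end

section
/- Let N = 17 · 31 · 41 · 43 · 89 · 97 · 167 · 331. Then N is composite and squarefree, and for every prime p dividing N, p² − 1 divides N − 1. Consequently N is a rigid Carmichael number of order 2; in particular, the map x ↦ x^N is a ring endomorphism of every commutative Z/NZ-algebra that can be generated as a Z/NZ-module by 2 elements. -/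
/-- A nilpotent element of a commutative algebra of dimension at most `m` over a field has
vanishing `m`-th power. -/
theorem pow_eq_zero_of_isNilpotent_of_finrank_le {F B : Type*} [Field F] [CommRing B]
    [Algebra F B] [Module.Finite F B] {m : ℕ} (hm : Module.finrank F B ≤ m) {a : B}
    (ha : IsNilpotent a) : a ^ m = 0 := by
  obtain ⟨k, hk⟩ := ha
  have h := Module.End.ker_pow_le_ker_pow_finrank (LinearMap.mulLeft F a) k
  have h1 : (1 : B) ∈ LinearMap.ker (LinearMap.mulLeft F a ^ k) := by
    simp [LinearMap.pow_mulLeft, hk]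
  have h2 := h h1
  simp only [LinearMap.pow_mulLeft, LinearMap.mem_ker, LinearMap.mulLeft_apply, mul_one] at h2
  exact pow_eq_zero_of_le hm h2

/-- In a commutative algebra of dimension at most `2` over the field with `p` elements,
`x ^ (p ^ 2) - x` is always nilpotent. -/
theorem isNilpotent_pow_sq_sub_self {p : ℕ} [Fact p.Prime] {B : Type*} [CommRing B]
    [Algebra (ZMod p) B] [Module.Finite (ZMod p) B] (h : Module.finrank (ZMod p) B ≤ 2) (x : B) :
    IsNilpotent (x ^ (p ^ 2) - x) := by
  rw [← mem_nilradical, nilradical, Ideal.radical_eq_sInf, Ideal.mem_sInf]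
  rintro P ⟨-, (_ : P.IsPrime)⟩
  have : Finite B := Module.finite_of_finite (ZMod p)
  have : Finite (B ⧸ P) := Finite.of_surjective _ Ideal.Quotient.mk_surjective
  let : Field (B ⧸ P) := (Finite.isField_of_domain (B ⧸ P)).toField
  let : Fintype (B ⧸ P) := Fintype.ofFinite _
  have hle : Module.finrank (ZMod p) (B ⧸ P) ≤ 2 :=
    (LinearMap.finrank_le_finrank_of_surjective
      (f := (Ideal.Quotient.mkₐ (ZMod p) P).toLinearMap) Ideal.Quotient.mk_surjective).trans h
  have hpos : 0 < Module.finrank (ZMod p) (B ⧸ P) := Module.finrank_pos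
  have hcard := Module.card_eq_pow_finrank (K := ZMod p) (V := B ⧸ P)
  rw [ZMod.card] at hcard
  have hx := FiniteField.pow_card (Ideal.Quotient.mk P x)
  have hx2 := FiniteField.pow_card_pow 2 (Ideal.Quotient.mk P x)
  rw [hcard] at hx hx2
  rw [← Ideal.Quotient.eq, map_pow]
  interval_cases Module.finrank (ZMod p) (B ⧸ P)
  · simpa using hx2
  · exact hx

/-- If `p ∣ N` and `p ^ 2 - 1 ∣ N - 1`, then `x ↦ x ^ N` agrees with `x ↦ x ^ (p ^ 2)` on
commutative algebras of dimension at most `2` over the field with `p` elements. -/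
theorem pow_eq_pow_sq_of_finrank_le_two {p N : ℕ} [hp : Fact p.Prime] (hN : 1 < N) (hpN : p ∣ N)
    (hd : p ^ 2 - 1 ∣ N - 1) {B : Type*} [CommRing B] [Algebra (ZMod p) B]
    [Module.Finite (ZMod p) B] (h : Module.finrank (ZMod p) B ≤ 2) (x : B) :
    x ^ N = x ^ (p ^ 2) := by
  rcases subsingleton_or_nontrivial B with _ | _
  · exact Subsingleton.elim _ _
  have : CharP B p := charP_of_injective_algebraMap (algebraMap (ZMod p) B).injective p
  have hp2 : 2 ≤ p := hp.out.two_le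
  have hpp : p ≤ p ^ 2 := Nat.le_self_pow two_ne_zero p
  have hle : p ^ 2 ≤ N := by
    have := Nat.le_of_dvd (by omega) hd
    omega
  have hd' : p ^ 2 - 1 ∣ N - p ^ 2 := by
    have := Nat.dvd_sub hd (dvd_refl (p ^ 2 - 1))
    rwa [show N - 1 - (p ^ 2 - 1) = N - p ^ 2 by omega] at this
  have hpd : p ∣ N - p ^ 2 := Nat.dvd_sub hpN (dvd_pow_self p two_ne_zero)
  have hcop : (p ^ 2 - 1).Coprime p := by
    have := Nat.coprime_self_sub_left (m := 1) (n := p ^ 2) (by omega)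
    exact (this.2 (Nat.coprime_one_left _)).coprime_dvd_right (dvd_pow_self p two_ne_zero)
  obtain ⟨k, hk⟩ := hcop.mul_dvd_of_dvd_of_dvd hd' hpd
  have hz : (x ^ (p ^ 2) - x) ^ p = 0 :=
    pow_eq_zero_of_isNilpotent_of_finrank_le (h.trans hp2) (isNilpotent_pow_sq_sub_self h x)
  have h1 : x ^ (p ^ 2) - x ∣ x * (x ^ ((p ^ 2 - 1) * k) - 1) := by
    have hfac : x ^ (p ^ 2) - x = x * (x ^ (p ^ 2 - 1) - 1) := by
      rw [mul_sub, mul_one, ← pow_succ', Nat.sub_add_cancel (by omega)]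
    rw [hfac, pow_mul]
    exact mul_dvd_mul_left x (sub_one_dvd_pow_sub_one _ _)
  have h2 : x ^ p * (x ^ (N - p ^ 2) - 1) = 0 := by
    have := pow_dvd_pow_of_dvd h1 p
    rw [hz, zero_dvd_iff, mul_pow, sub_pow_char, one_pow, ← pow_mul] at this
    rwa [hk, show (p ^ 2 - 1) * p * k = (p ^ 2 - 1) * k * p by ring]
  have h3 : x ^ N - x ^ (p ^ 2) = x ^ (p ^ 2 - p) * (x ^ p * (x ^ (N - p ^ 2) - 1)) := by
    rw [← mul_assoc, ← pow_add, Nat.sub_add_cancel hpp, mul_sub, mul_one, ← pow_add,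
      Nat.add_sub_cancel' hle]
  rw [← sub_eq_zero, h3, h2, mul_zero]

/-- If `p ∣ N` and `p ^ 2 - 1 ∣ N - 1`, then `x ↦ x ^ N` is additive modulo `p` on every commutative
ring whose additive group is generated by two elements. -/
theorem natCast_dvd_add_pow_sub {p N : ℕ} (hp : p.Prime) (hN : 1 < N) (hpN : p ∣ N)
    (hd : p ^ 2 - 1 ∣ N - 1) {A : Type*} [CommRing A] {s : Finset A} (hs : s.card ≤ 2)
    (hspan : Submodule.span ℤ (s : Set A) = ⊤) (x y : A) :
    (p : A) ∣ (x + y) ^ N - (x ^ N + y ^ N) := by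
  classical
  have : Fact p.Prime := ⟨hp⟩
  set I : Ideal A := Ideal.span {(p : A)} with hI
  rw [← Ideal.mem_span_singleton, ← hI, ← Ideal.Quotient.eq]
  rcases subsingleton_or_nontrivial (A ⧸ I) with _ | _
  · exact Subsingleton.elim _ _
  have hp0 : (p : A ⧸ I) = 0 := by
    rw [← map_natCast (Ideal.Quotient.mk I), Ideal.Quotient.eq_zero_iff_mem]
    exact Ideal.mem_span_singleton_self _
  have : CharP (A ⧸ I) p := by
    have := CharP.ringChar_of_prime_eq_zero hp hp0
    exact ringChar.of_eq this
  let : Algebra (ZMod p) (A ⧸ I) := ZMod.algebra (A ⧸ I) p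
  have htop : Submodule.span (ZMod p) ((s.image (Ideal.Quotient.mk I) : Finset (A ⧸ I)) :
      Set (A ⧸ I)) = ⊤ := by
    rw [← Submodule.restrictScalars_eq_top_iff ℤ,
      Submodule.restrictScalars_span ℤ (ZMod p) ZMod.intCast_surjective, Finset.coe_image]
    have := congrArg (Submodule.map (Ideal.Quotient.mk I).toAddMonoidHom.toIntLinearMap) hspan
    rw [Submodule.map_span, Submodule.map_top, LinearMap.range_eq_top.2] at this
    · exact this
    · exact Ideal.Quotient.mk_surjective
  have : Module.Finite (ZMod p) (A ⧸ I) := ⟨⟨_, htop⟩⟩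
  have hrank : Module.finrank (ZMod p) (A ⧸ I) ≤ 2 := by
    rw [← finrank_top (ZMod p) (A ⧸ I), ← htop]
    exact (finrank_span_finset_le_card (R := ZMod p) _).trans (Finset.card_image_le.trans hs)
  simp only [map_add, map_pow, pow_eq_pow_sq_of_finrank_le_two hN hpN hd hrank]
  exact add_pow_char_pow (p := p) (n := 2) (Ideal.Quotient.mk I x) (Ideal.Quotient.mk I y)

/-- A squarefree `N > 1` with `p ^ 2 - 1 ∣ N - 1` for all primes `p ∣ N` has the property that
`x ↦ x ^ N` is additive on commutative `ZMod N`-algebras generated by two elements as a module. -/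
theorem add_pow_of_squarefree_of_sq_sub_one_dvd {N : ℕ} (hN : 1 < N) (hsq : Squarefree N)
    (hd : ∀ p : ℕ, p.Prime → p ∣ N → p ^ 2 - 1 ∣ N - 1) {A : Type*} [CommRing A]
    [Algebra (ZMod N) A] {s : Finset A} (hs : s.card ≤ 2)
    (hspan : Submodule.span (ZMod N) (s : Set A) = ⊤) (x y : A) :
    (x + y) ^ N = x ^ N + y ^ N := by
  have hspan' : Submodule.span ℤ (s : Set A) = ⊤ := by
    rw [← Submodule.restrictScalars_span ℤ (ZMod N) ZMod.intCast_surjective, hspan,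
      Submodule.restrictScalars_top]
  have hN0 : (N : A) = 0 := by
    rw [← map_natCast (algebraMap (ZMod N) A), ZMod.natCast_self, map_zero]
  have hdvd : ∏ p ∈ N.primeFactors, (p : A) ∣ (x + y) ^ N - (x ^ N + y ^ N) := by
    refine Finset.prod_dvd_of_coprime (fun p hp q hq hpq => ?_) fun p hp => ?_
    · exact ((Nat.coprime_primes (Nat.prime_of_mem_primeFactors hp)
        (Nat.prime_of_mem_primeFactors hq)).2 hpq).cast
    · have hp' := Nat.prime_of_mem_primeFactors hp
      have hpN := Nat.dvd_of_mem_primeFactors hp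
      exact natCast_dvd_add_pow_sub hp' hN hpN (hd p hp' hpN) hs hspan' x y
  rw [← Nat.cast_prod, Nat.prod_primeFactors_of_squarefree hsq, hN0, zero_dvd_iff] at hdvd
  exact sub_eq_zero.1 hdvd


/-- The number `N = 17·31·41·43·89·97·167·331` (from Pinch's list) is a squarefree
composite number with `p² − 1 ∣ N − 1` for every prime `p ∣ N`; consequently it is a
rigid Carmichael number of order 2, and in particular `x ↦ x^N` is a ring endomorphism
of every commutative `ZMod N`-algebra generated as a `ZMod N`-module by 2 elements. -/
theorem stmt_14 :
    let N : ℕ := 17 * 31 * 41 * 43 * 89 * 97 * 167 * 331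
    1 < N ∧ ¬ N.Prime ∧ Squarefree N ∧
      (∀ p : ℕ, p.Prime → p ∣ N → p ^ 2 - 1 ∣ N - 1) ∧
      (∀ (A : Type) [CommRing A] [Algebra (ZMod N) A],
        (∃ s : Finset A, s.card ≤ 2 ∧ Submodule.span (ZMod N) (s : Set A) = ⊤) →
        ∀ x y : A, (x + y) ^ N = x ^ N + y ^ N) := by
  intro N
  have hN : 1 < N := by norm_num [N]
  have hsq : Squarefree N := by
    have hprime : ∀ p ∈ [17, 31, 41, 43, 89, 97, 167, 331], Nat.Prime p := by norm_num
    simp only [N]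
    simp only [List.mem_cons, List.not_mem_nil, or_false, forall_eq_or_imp, forall_eq] at hprime
    obtain ⟨h1, h2, h3, h4, h5, h6, h7, h8⟩ := hprime
    iterate 7 rw [Nat.squarefree_mul (by norm_num)]
    exact ⟨⟨⟨⟨⟨⟨⟨h1.squarefree, h2.squarefree⟩, h3.squarefree⟩, h4.squarefree⟩, h5.squarefree⟩,
      h6.squarefree⟩, h7.squarefree⟩, h8.squarefree⟩
  have hd : ∀ p : ℕ, p.Prime → p ∣ N → p ^ 2 - 1 ∣ N - 1 := by
    intro p hp hpN
    simp only [N, hp.dvd_mul] at hpN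
    rcases hpN with ((((((h | h) | h) | h) | h) | h) | h) | h <;>
    · rw [Nat.prime_dvd_prime_iff_eq hp (by norm_num)] at h
      subst h
      norm_num [N]
  refine ⟨hN, ?_, hsq, hd, ?_⟩
  · exact Nat.not_prime_mul (by norm_num) (by norm_num)
  · rintro A _ _ ⟨s, hs, hspan⟩ x y
    exact add_pow_of_squarefree_of_sq_sub_one_dvd hN hsq hd hs hspan x y
end
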